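/- Let 0 < γ < α ≤ 2 and β ≥ 0, and let A be densely defined with dense range, generating a tempered (α,β)-ROF R_{α,β;A}. Then for all x ∈ X, t > 0, the function R_{γ;A^{-1}}(t)x := x - t^{γ(1+β)/α} ∫₀^∞ φ(γ/α, 1+γ(1+β)/α; -s t^{γ/α}) R_{α,β;A}(s)x ds is well-defined (the integral converges absolutely), uniformly bounded in t, and its Laplace transform satisfies ∫₀^∞ e^{-λt} R_{γ;A^{-1}}(t)x dt = λ^{γ-1}(λ^γ - A^{-1})^{-1}x for Re λ > 0; i.e., R_{γ;A^{-1}} is the γ-ROF generated by A^{-1}. -/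

import Mathlib

open MeasureTheory Set

/-- The Wright function `φ(ρ, μ; z) = ∑ z^k/(k! Γ(ρk+μ))`. -/
noncomputable def wright (ρ : ℝ) (μ : ℂ) (z : ℂ) : ℂ :=
  ∑' k : ℕ, z ^ k / ((k.factorial : ℂ) * Complex.Gamma ((ρ : ℂ) * k + μ))

/-- Bessel function of the first kind of real order `ν` at a real argument. -/
noncomputable def besselJ (ν : ℝ) (x : ℝ) : ℝ :=
  (x / 2) ^ ν * ∑' k : ℕ, (-1 : ℝ) ^ k * (x / 2) ^ (2 * k) /
    ((k.factorial : ℝ) * Real.Gamma (ν + k + 1))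

/-- Mittag-Leffler function. -/
noncomputable def mittagLeffler (a m : ℝ) (z : ℂ) : ℂ :=
  ∑' k : ℕ, z ^ k / Complex.Gamma ((a : ℂ) * k + m)

variable {X : Type*} [NormedAddCommGroup X] [NormedSpace ℂ X]

/-- `R` is the (bounded, everywhere-defined) resolvent `(z - A)⁻¹` of the
(possibly unbounded) linear operator `A`; i.e. `z ∈ ρ(A)`. -/
structure IsResolventOf (A : X →ₗ.[ℂ] X) (z : ℂ) (R : X →L[ℂ] X) : Prop where
  mem : ∀ x : X, R x ∈ A.domain
  right : ∀ x : X, z • R x - A ⟨R x, mem x⟩ = x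
  left : ∀ y : A.domain, R (z • (y : X) - A y) = y

/-- The open sector of half-angle `θ` around the positive real axis. -/
def sect (θ : ℝ) : Set ℂ := {z : ℂ | z ≠ 0 ∧ |Complex.arg z| < θ}

/-- `A` is sectorial of angle `ω`: the spectrum lies in the closed sector of angle `ω`
(resolvents exist outside) and `‖z(z-A)⁻¹‖` is uniformly bounded outside each bigger
closed sector. -/
def IsSectorial (A : X →ₗ.[ℂ] X) (ω : ℝ) : Prop :=
  (∀ z ∈ (closure (sect ω))ᶜ, ∃ R : X →L[ℂ] X, IsResolventOf A z R) ∧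
  ∀ ω' ∈ Set.Ioo ω Real.pi, ∃ M : ℝ,
    ∀ z ∈ (closure (sect ω'))ᶜ, ∀ R : X →L[ℂ] X, IsResolventOf A z R → ‖z‖ * ‖R‖ ≤ M

/-- `B = A⁻¹` as an unbounded operator. -/
def IsInverseOf (B A : X →ₗ.[ℂ] X) : Prop :=
  (∀ x : A.domain, ∃ h : A x ∈ B.domain, B ⟨A x, h⟩ = (x : X)) ∧
  (∀ y : B.domain, ∃ h : B y ∈ A.domain, A ⟨B y, h⟩ = (y : X))

/-- Riemann–Liouville fractional integral of order `μ > 0`. -/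
noncomputable def fracInt (μ : ℝ) (f : ℝ → X) (t : ℝ) : X :=
  ∫ s in Set.Ioo 0 t, ((t - s) ^ (μ - 1) / Real.Gamma μ) • f s

/-- `S` is a `β`-times integrated `α`-resolvent operator function generated by `A`,
with exponential bound `M e^{ω t}`. -/
structure IsROF (A : X →ₗ.[ℂ] X) (α β : ℝ) (S : ℝ → X →L[ℂ] X) (ω M : ℝ) : Prop where
  cont : ∀ x : X, ContinuousOn (fun t : ℝ => S t x) (Set.Ici 0)
  bound : ∀ t : ℝ, 0 ≤ t → ‖S t‖ ≤ M * Real.exp (ω * t)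
  laplace : ∀ l : ℝ, ω < l → ∃ R : X →L[ℂ] X,
    IsResolventOf A ((l ^ α : ℝ) : ℂ) R ∧
    ∀ x : X, ((l ^ (α - β - 1) : ℝ) : ℂ) • R x =
      ∫ t in Set.Ioi (0 : ℝ), Real.exp (-(l * t)) • S t x

/-- `S` is a tempered `β`-times integrated `α`-resolvent operator function generated
by `A`: `‖S t‖ ≤ M t^β` and the Laplace-transform identity holds for all `λ > 0`. -/
structure IsTemperedROF (A : X →ₗ.[ℂ] X) (α β : ℝ) (S : ℝ → X →L[ℂ] X) (M : ℝ) : Prop where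
  cont : ∀ x : X, ContinuousOn (fun t : ℝ => S t x) (Set.Ici 0)
  bound : ∀ t : ℝ, 0 ≤ t → ‖S t‖ ≤ M * t ^ β
  laplace : ∀ l : ℝ, 0 < l → ∃ R : X →L[ℂ] X,
    IsResolventOf A ((l ^ α : ℝ) : ℂ) R ∧
    ∀ x : X, ((l ^ (α - β - 1) : ℝ) : ℂ) • R x =
      ∫ t in Set.Ioi (0 : ℝ), Real.exp (-(l * t)) • S t x



theorem integrableOn_rpow_mul_exp_neg_mul_Ioi {b a : ℝ} (hb : -1 < b) (ha : 0 < a) :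
    IntegrableOn (fun t : ℝ => t ^ b * Real.exp (-a * t)) (Ioi 0) := by
  simpa using integrableOn_rpow_mul_exp_neg_mul_rpow hb one_pos ha

/-- The norm of a Laplace integrand is dominated by a gamma-type integrand. -/
theorem integrableOn_laplace {E : Type*} [NormedAddCommGroup E] [NormedSpace ℂ E]
    {f : ℝ → E} {M b : ℝ} (hb : -1 < b) (hf : ContinuousOn f (Ioi 0))
    (hM : ∀ t, 0 < t → ‖f t‖ ≤ M * t ^ b) {w : ℂ} (hw : 0 < w.re) :
    IntegrableOn (fun t : ℝ => Complex.exp (-w * t) • f t) (Ioi 0) := by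
  refine Integrable.mono' ((integrableOn_rpow_mul_exp_neg_mul_Ioi hb hw).const_mul M) ?_ ?_
  · refine ContinuousOn.aestronglyMeasurable ?_ measurableSet_Ioi
    exact ContinuousOn.smul (by fun_prop) hf
  · filter_upwards [ae_restrict_mem measurableSet_Ioi] with t ht
    rw [norm_smul, Complex.norm_exp]
    have h1 : (-w * (t : ℂ)).re = -w.re * t := by simp
    rw [h1, mul_comm, ← mul_assoc]
    exact mul_le_mul_of_nonneg_right (hM t ht) (Real.exp_pos _).le

/-- The Laplace transform of a function of polynomial growth is holomorphic on the right
half-plane. -/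
theorem differentiableOn_laplace {E : Type*} [NormedAddCommGroup E] [NormedSpace ℂ E]
    {f : ℝ → E} {M b : ℝ} (hb : -1 < b) (hf : ContinuousOn f (Ioi 0))
    (hM : ∀ t, 0 < t → ‖f t‖ ≤ M * t ^ b) :
    DifferentiableOn ℂ (fun w : ℂ => ∫ t in Ioi (0 : ℝ), Complex.exp (-w * t) • f t)
      {w | 0 < w.re} := by
  intro w hw
  have hw' : 0 < w.re := hw
  refine DifferentiableAt.differentiableWithinAt ?_
  have hs : {z : ℂ | w.re / 2 < z.re} ∈ nhds w :=
    (isOpen_lt continuous_const Complex.continuous_re).mem_nhds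
      (show w.re / 2 < w.re by linarith)
  have key := hasDerivAt_integral_of_dominated_loc_of_deriv_le (μ := volume.restrict (Ioi 0))
    (F := fun (z : ℂ) (t : ℝ) => Complex.exp (-z * t) • f t)
    (F' := fun (z : ℂ) (t : ℝ) => (-(t : ℂ) * Complex.exp (-z * t)) • f t)
    (bound := fun t : ℝ => M * (t ^ (b + 1) * Real.exp (-(w.re / 2) * t))) hs ?_
    (integrableOn_laplace hb hf hM hw') ?_ ?_ ?_ ?_
  · exact key.2.differentiableAt
  · refine Filter.Eventually.of_forall fun z => ?_
    exact ContinuousOn.aestronglyMeasurable (ContinuousOn.smul (by fun_prop) hf) measurableSet_Ioi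
  · exact ContinuousOn.aestronglyMeasurable (ContinuousOn.smul (by fun_prop) hf) measurableSet_Ioi
  · filter_upwards [ae_restrict_mem measurableSet_Ioi] with t ht z hz
    have ht' : 0 < t := ht
    have hz' : w.re / 2 < z.re := hz
    rw [norm_smul, norm_mul, norm_neg, Complex.norm_exp, Complex.norm_real, Real.norm_eq_abs,
      abs_of_pos ht']
    have h1 : (-z * (t : ℂ)).re = -z.re * t := by simp
    rw [h1, Real.rpow_add ht', Real.rpow_one]
    have h2 : Real.exp (-z.re * t) ≤ Real.exp (-(w.re / 2) * t) := by
      apply Real.exp_le_exp.mpr; nlinarith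
    calc t * Real.exp (-z.re * t) * ‖f t‖
        ≤ t * Real.exp (-(w.re / 2) * t) * (M * t ^ b) := by
          apply mul_le_mul _ (hM t ht') (norm_nonneg _) (by positivity)
          exact mul_le_mul_of_nonneg_left h2 ht'.le
      _ = _ := by ring
  · exact (integrableOn_rpow_mul_exp_neg_mul_Ioi (by linarith) (by linarith)).const_mul M
  · filter_upwards with t z _
    have h1 : HasDerivAt (fun z : ℂ => -z * (t : ℂ)) (-(t : ℂ)) z := by
      simpa using ((hasDerivAt_id z).neg.mul_const (t : ℂ))
    have h2 := h1.cexp.smul_const (f t)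
    convert h2 using 2
    ring

theorem isOpen_rightHalfPlane : IsOpen {w : ℂ | 0 < w.re} :=
  isOpen_lt continuous_const Complex.continuous_re

/-- Functions holomorphic on the right half-plane that agree on the positive reals coincide. -/
theorem eqOn_rightHalfPlane {E : Type*} [NormedAddCommGroup E] [NormedSpace ℂ E] [CompleteSpace E]
    {f g : ℂ → E} (hf : DifferentiableOn ℂ f {w | 0 < w.re})
    (hg : DifferentiableOn ℂ g {w | 0 < w.re})
    (h : ∀ r : ℝ, 0 < r → f r = g r) : EqOn f g {w | 0 < w.re} := by
  refine (hf.analyticOnNhd isOpen_rightHalfPlane).eqOn_of_preconnected_of_frequently_eq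
    (z₀ := ((1 : ℝ) : ℂ)) (hg.analyticOnNhd isOpen_rightHalfPlane)
    (convex_halfSpace_re_gt 0).isPreconnected (by simp) ?_
  have ht : Filter.Tendsto (fun r : ℝ => (r : ℂ)) (nhdsWithin 1 {(1 : ℝ)}ᶜ)
      (nhdsWithin ((1 : ℝ) : ℂ) {((1 : ℝ) : ℂ)}ᶜ) := by
    refine tendsto_nhdsWithin_iff.mpr ⟨?_, ?_⟩
    · exact (Complex.continuous_ofReal.tendsto 1).mono_left nhdsWithin_le_nhds
    · filter_upwards [self_mem_nhdsWithin] with r hr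
      simpa using hr
  refine ht.frequently (Filter.Eventually.frequently ?_)
  filter_upwards [nhdsWithin_le_nhds (lt_mem_nhds one_pos)] with r hr
  exact h r hr

theorem integral_cexp_neg_mul_mul_rpow {a : ℝ} (ha : 0 < a) {w : ℂ} (hw : 0 < w.re) :
    ∫ t in Ioi (0 : ℝ), Complex.exp (-w * t) * ((t ^ (a - 1) : ℝ) : ℂ) =
      w ^ (-(a : ℂ)) * Complex.Gamma a := by
  have hd := differentiableOn_laplace (f := fun t : ℝ => ((t ^ (a - 1) : ℝ) : ℂ)) (M := 1)
    (b := a - 1) (by linarith)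
    (Complex.continuous_ofReal.comp_continuousOn
      (continuousOn_id.rpow_const fun t ht => Or.inl (ne_of_gt ht))) (by
      intro t ht
      rw [Complex.norm_real, Real.norm_eq_abs, abs_of_pos (Real.rpow_pos_of_pos ht _), one_mul])
  refine eqOn_rightHalfPlane (g := fun w : ℂ => w ^ (-(a : ℂ)) * Complex.Gamma a) hd ?_ ?_ hw
  · refine DifferentiableOn.mul_const ?_ _
    intro z hz
    exact (differentiableAt_id.cpow_const (Or.inl hz)).differentiableWithinAt
  · intro r hr
    have h := Complex.integral_cpow_mul_exp_neg_mul_Ioi (a := a) (r := r) (by simpa using ha) hr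
    have h2 : ((1 : ℂ) / r) ^ (a : ℂ) = (r : ℂ) ^ (-(a : ℂ)) := by
      rw [one_div, Complex.cpow_neg, Complex.inv_cpow]
      rw [Complex.arg_ofReal_of_nonneg hr.le]
      exact Real.pi_pos.ne
    rw [← h2, ← h]
    refine setIntegral_congr_fun measurableSet_Ioi fun t ht => ?_
    have ht' : 0 < t := ht
    simp only [smul_eq_mul]
    rw [mul_comm, Complex.ofReal_cpow ht'.le]
    push_cast
    ring_nf

theorem integrable_tsum_of_summable_integral_norm {α E : Type*} [MeasurableSpace α]
    {μ : Measure α} [NormedAddCommGroup E] [CompleteSpace E]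
    {F : ℕ → α → E} (hF : ∀ i, Integrable (F i) μ)
    (hs : Summable fun i => ∫ a, ‖F i a‖ ∂μ)
    (hm : AEStronglyMeasurable (fun a => ∑' i, F i a) μ) :
    Integrable (fun a => ∑' i, F i a) μ := by
  refine ⟨hm, ?_⟩
  have h1 : ∀ i, ∫⁻ a, ‖F i a‖ₑ ∂μ = ENNReal.ofReal (∫ a, ‖F i a‖ ∂μ) := fun i =>
    (ofReal_integral_norm_eq_lintegral_enorm (hF i)).symm
  calc ∫⁻ a, ‖∑' i, F i a‖ₑ ∂μ ≤ ∫⁻ a, ∑' i, ‖F i a‖ₑ ∂μ :=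
        lintegral_mono fun a => enorm_tsum_le_tsum_enorm
    _ = ∑' i, ∫⁻ a, ‖F i a‖ₑ ∂μ := lintegral_tsum fun i => (hF i).1.enorm
    _ = ∑' i, ENNReal.ofReal (∫ a, ‖F i a‖ ∂μ) := by simp_rw [h1]
    _ = ENNReal.ofReal (∑' i, ∫ a, ‖F i a‖ ∂μ) :=
        (ENNReal.ofReal_tsum_of_nonneg (fun i => integral_nonneg fun a => norm_nonneg _) hs).symm
    _ < ⊤ := ENNReal.ofReal_lt_top

theorem one_half_le_Gamma {x : ℝ} (hx : 1 ≤ x) : 1 / 2 ≤ Real.Gamma x := by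
  rcases le_total 2 x with h | h
  · have := Real.Gamma_strictMonoOn_Ici.monotoneOn (a := 2) (b := x) (by simp) h h
    rw [Real.Gamma_two] at this
    linarith
  · have h1 := Real.Gamma_strictMonoOn_Ici.monotoneOn (a := 2) (b := x + 1) (by simp)
      (show (2 : ℝ) ≤ x + 1 by linarith) (by linarith)
    rw [Real.Gamma_two, Real.Gamma_add_one (by linarith)] at h1
    have h2 := Real.Gamma_pos_of_pos (show 0 < x by linarith)
    nlinarith

theorem wright_ofReal_eq (ρ μ : ℝ) (z : ℂ) :
    wright ρ (μ : ℂ) z =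
      ∑' k : ℕ, z ^ k / ((k.factorial : ℂ) * ((Real.Gamma (ρ * k + μ) : ℝ) : ℂ)) := by
  unfold wright
  refine tsum_congr fun k => ?_
  rw [← Complex.Gamma_ofReal]
  push_cast
  rfl

theorem norm_wright_term_le {ρ μ : ℝ} (hρ : 0 ≤ ρ) (hμ : 1 ≤ μ) (z : ℂ) (k : ℕ) :
    ‖z ^ k / ((k.factorial : ℂ) * ((Real.Gamma (ρ * k + μ) : ℝ) : ℂ))‖ ≤
      2 * (‖z‖ ^ k / k.factorial) := by
  have h0 : 1 ≤ ρ * k + μ := by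
    have : 0 ≤ ρ * k := by positivity
    linarith
  have h := one_half_le_Gamma h0
  have hk : (0 : ℝ) < k.factorial := by positivity
  rw [norm_div, norm_mul, norm_pow, Complex.norm_natCast, Complex.norm_real, Real.norm_eq_abs,
    abs_of_pos (by linarith), ← div_div, div_le_iff₀ (by linarith)]
  have h1 : 0 ≤ ‖z‖ ^ k / k.factorial := by positivity
  nlinarith

theorem summable_wright {ρ μ : ℝ} (hρ : 0 ≤ ρ) (hμ : 1 ≤ μ) (z : ℂ) :
    Summable fun k : ℕ => z ^ k / ((k.factorial : ℂ) * ((Real.Gamma (ρ * k + μ) : ℝ) : ℂ)) :=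
  Summable.of_norm_bounded ((Real.summable_pow_div_factorial ‖z‖).mul_left 2)
    (norm_wright_term_le hρ hμ z)

theorem continuous_wright {ρ μ : ℝ} (hρ : 0 ≤ ρ) (hμ : 1 ≤ μ) :
    Continuous fun z : ℂ => wright ρ (μ : ℂ) z := by
  refine continuous_iff_continuousAt.mpr fun z₀ => ?_
  simp_rw [wright_ofReal_eq]
  have h : ContinuousOn (fun z : ℂ => ∑' k : ℕ,
      z ^ k / ((k.factorial : ℂ) * ((Real.Gamma (ρ * k + μ) : ℝ) : ℂ)))
      (Metric.ball 0 (‖z₀‖ + 1)) := by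
    refine continuousOn_tsum (u := fun k => 2 * ((‖z₀‖ + 1) ^ k / k.factorial)) ?_
      ((Real.summable_pow_div_factorial (‖z₀‖ + 1)).mul_left 2) ?_
    · intro k
      fun_prop
    · intro k z hz
      refine (norm_wright_term_le hρ hμ z k).trans ?_
      have h1 : ‖z‖ ≤ ‖z₀‖ + 1 := (mem_ball_zero_iff.mp hz).le
      have h2 := pow_le_pow_left₀ (norm_nonneg z) h1 k
      exact mul_le_mul_of_nonneg_left (div_le_div_of_nonneg_right h2 (Nat.cast_nonneg _)) two_pos.le
  exact h.continuousAt (Metric.isOpen_ball.mem_nhds (by simp))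

theorem wright_recurrence {ρ μ : ℝ} (hρ : 0 ≤ ρ) (hμ : 1 ≤ μ) (z : ℂ) :
    wright ρ (μ : ℂ) z =
      μ * wright ρ ((μ + 1 : ℝ) : ℂ) z + ρ * z * wright ρ ((μ + 1 + ρ : ℝ) : ℂ) z := by
  have hG : ∀ k : ℕ, Real.Gamma (ρ * k + (μ + 1)) = (ρ * k + μ) * Real.Gamma (ρ * k + μ) := by
    intro k
    have : 0 ≤ ρ * k := by positivity
    rw [← add_assoc, Real.Gamma_add_one (by linarith)]
  have hp : ∀ k : ℕ, 0 < ρ * k + μ := fun k => by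
    have : 0 ≤ ρ * k := by positivity
    linarith
  rw [wright_ofReal_eq, wright_ofReal_eq, wright_ofReal_eq, ← tsum_mul_left, ← tsum_mul_left]
  have s1 := (summable_wright hρ hμ z)
  have s2 := (summable_wright hρ (show 1 ≤ μ + 1 by linarith) z).mul_left (μ : ℂ)
  have e : ∀ k : ℕ, z ^ k / ((k.factorial : ℂ) * ((Real.Gamma (ρ * k + μ) : ℝ) : ℂ)) -
      μ * (z ^ k / ((k.factorial : ℂ) * ((Real.Gamma (ρ * k + (μ + 1)) : ℝ) : ℂ))) =
      ρ * k * (z ^ k / ((k.factorial : ℂ) * ((Real.Gamma (ρ * k + (μ + 1)) : ℝ) : ℂ))) := by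
    intro k
    have h1 : ((Real.Gamma (ρ * k + μ) : ℝ) : ℂ) ≠ 0 :=
      Complex.ofReal_ne_zero.mpr (Real.Gamma_pos_of_pos (hp k)).ne'
    have h2 : ((ρ : ℂ) * k + μ) ≠ 0 := by
      have := Complex.ofReal_ne_zero.mpr (hp k).ne'
      simpa using this
    have h3 : (k.factorial : ℂ) ≠ 0 := Nat.cast_ne_zero.mpr k.factorial_ne_zero
    rw [hG]
    push_cast
    field_simp
    ring
  rw [← sub_eq_iff_eq_add', ← s1.tsum_sub s2, tsum_congr e]
  have s3 := s1.sub s2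
  rw [summable_congr e] at s3
  rw [s3.tsum_eq_zero_add]
  simp only [Nat.cast_zero, mul_zero, zero_mul, zero_add]
  refine tsum_congr fun k => ?_
  have h3 : (k.factorial : ℂ) ≠ 0 := Nat.cast_ne_zero.mpr k.factorial_ne_zero
  have h4 : ((k : ℂ) + 1) ≠ 0 := by exact_mod_cast k.succ_ne_zero
  have h5 : ρ * ((k + 1 : ℕ) : ℝ) + (μ + 1) = ρ * k + (μ + 1 + ρ) := by push_cast; ring
  have h6 : ((Real.Gamma (ρ * k + (μ + 1 + ρ)) : ℝ) : ℂ) ≠ 0 := by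
    have := hp k
    exact Complex.ofReal_ne_zero.mpr (Real.Gamma_pos_of_pos (by linarith)).ne'
  rw [h5, Nat.factorial_succ]
  push_cast
  field_simp
  ring

/-- The Laplace transform of `s ^ (μ - 1) φ(ρ, μ; z s ^ ρ)`. -/
theorem laplace_wright {ρ μ : ℝ} (hρ : 0 < ρ) (hμ : 1 ≤ μ) (z : ℂ) {w : ℂ}
    (hw : 0 < w.re) :
    IntegrableOn (fun s : ℝ => Complex.exp (-w * s) * (((s ^ (μ - 1) : ℝ) : ℂ) *
      wright ρ (μ : ℂ) (z * ((s ^ ρ : ℝ) : ℂ)))) (Ioi 0) ∧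
    ∫ s in Ioi (0 : ℝ), Complex.exp (-w * s) * (((s ^ (μ - 1) : ℝ) : ℂ) *
      wright ρ (μ : ℂ) (z * ((s ^ ρ : ℝ) : ℂ))) =
      w ^ (-(μ : ℂ)) * Complex.exp (z * w ^ (-(ρ : ℂ))) := by
  set c : ℕ → ℂ := fun k => z ^ k / ((k.factorial : ℂ) * ((Real.Gamma (ρ * k + μ) : ℝ) : ℂ))
    with hc
  set F : ℕ → ℝ → ℂ := fun k s =>
    c k * (Complex.exp (-w * s) * ((s ^ (ρ * k + μ - 1) : ℝ) : ℂ)) with hF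
  have hp : ∀ k : ℕ, 1 ≤ ρ * k + μ := fun k => by
    have : 0 ≤ ρ * k := by positivity
    linarith
  have hw0 : w ≠ 0 := by rintro rfl; simp at hw
  have hcont : ∀ a : ℝ, ContinuousOn (fun s : ℝ => ((s ^ a : ℝ) : ℂ)) (Ioi 0) := fun a =>
    Complex.continuous_ofReal.comp_continuousOn
      (continuousOn_id.rpow_const fun t ht => Or.inl (ne_of_gt ht))
  have hint : ∀ k, Integrable (F k) (volume.restrict (Ioi 0)) := fun k => by
    refine Integrable.const_mul ?_ _
    exact integrableOn_laplace (f := fun s : ℝ => ((s ^ (ρ * k + μ - 1) : ℝ) : ℂ)) (M := 1)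
      (b := ρ * k + μ - 1) (by linarith [hp k]) (hcont _) (fun t ht => by
        rw [Complex.norm_real, Real.norm_eq_abs, abs_of_pos (Real.rpow_pos_of_pos ht _), one_mul])
      hw
  have hsum : Summable fun k => ∫ s in Ioi (0 : ℝ), ‖F k s‖ := by
    have e : ∀ k, ∫ s in Ioi (0 : ℝ), ‖F k s‖ =
        (1 / w.re) ^ μ * ((‖z‖ * (1 / w.re) ^ ρ) ^ k / k.factorial) := by
      intro k
      have hG := Real.Gamma_pos_of_pos (show 0 < ρ * k + μ by linarith [hp k])
      have e1 : ∫ s in Ioi (0 : ℝ), ‖F k s‖ = ∫ s in Ioi (0 : ℝ),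
          ‖c k‖ * (s ^ (ρ * k + μ - 1) * Real.exp (-(w.re * s))) := by
        refine setIntegral_congr_fun measurableSet_Ioi fun s hs => ?_
        have hs' : 0 < s := hs
        simp only [hF]
        rw [norm_mul, norm_mul, Complex.norm_exp, Complex.norm_real, Real.norm_eq_abs,
          abs_of_pos (Real.rpow_pos_of_pos hs' _)]
        have : (-w * (s : ℂ)).re = -(w.re * s) := by simp
        rw [this]
        ring
      rw [e1, integral_const_mul,
        Real.integral_rpow_mul_exp_neg_mul_Ioi (by linarith [hp k]) hw]
      simp only [hc]
      rw [norm_div, norm_mul, norm_pow, Complex.norm_natCast, Complex.norm_real,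
        Real.norm_eq_abs, abs_of_pos hG, mul_pow, ← Real.rpow_natCast ((1 / w.re) ^ ρ) k,
        ← Real.rpow_mul (by positivity), Real.rpow_add (by positivity)]
      have : (k.factorial : ℝ) ≠ 0 := by positivity
      field_simp
    simp_rw [e]
    exact (Real.summable_pow_div_factorial _).mul_left _
  have heq : EqOn (fun s : ℝ => Complex.exp (-w * s) * (((s ^ (μ - 1) : ℝ) : ℂ) *
      wright ρ (μ : ℂ) (z * ((s ^ ρ : ℝ) : ℂ)))) (fun s => ∑' k, F k s) (Ioi 0) := by
    intro s hs
    have hs' : 0 < s := hs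
    simp only
    rw [wright_ofReal_eq, ← mul_assoc, ← tsum_mul_left]
    refine tsum_congr fun k => ?_
    simp only [hF, hc]
    have e1 : s ^ (ρ * k + μ - 1) = (s ^ ρ) ^ k * s ^ (μ - 1) := by
      rw [← Real.rpow_natCast (s ^ ρ) k, ← Real.rpow_mul hs'.le, ← Real.rpow_add hs']
      ring_nf
    rw [e1]
    push_cast
    ring
  have hmeas : AEStronglyMeasurable (fun s : ℝ => Complex.exp (-w * s) *
      (((s ^ (μ - 1) : ℝ) : ℂ) * wright ρ (μ : ℂ) (z * ((s ^ ρ : ℝ) : ℂ))))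
      (volume.restrict (Ioi 0)) := by
    refine ContinuousOn.aestronglyMeasurable ?_ measurableSet_Ioi
    refine ContinuousOn.mul (by fun_prop) ((hcont _).mul ?_)
    exact (continuous_wright hρ.le hμ).comp_continuousOn (continuousOn_const.mul (hcont _))
  have hae := heq.aeEq_restrict (μ := volume) measurableSet_Ioi
  refine ⟨(integrable_tsum_of_summable_integral_norm hint hsum (hmeas.congr hae)).congr hae.symm,
    ?_⟩
  rw [integral_congr_ae hae]
  have hS := (hasSum_integral_of_summable_integral_norm hint hsum).unique
    (a₂ := w ^ (-(μ : ℂ)) * Complex.exp (z * w ^ (-(ρ : ℂ)))) ?_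
  · exact hS
  have hE := (NormedSpace.expSeries_div_hasSum_exp (𝔸 := ℂ) (z * w ^ (-(ρ : ℂ)))).mul_left
    (w ^ (-(μ : ℂ)))
  rw [← Complex.exp_eq_exp_ℂ] at hE
  suffices hk : ∀ k, w ^ (-(μ : ℂ)) * ((z * w ^ (-(ρ : ℂ))) ^ k / k.factorial) =
      ∫ s in Ioi (0 : ℝ), F k s by
    rw [funext hk] at hE
    exact hE
  intro k
  simp only [hF]
  rw [integral_const_mul, integral_cexp_neg_mul_mul_rpow (by linarith [hp k]) hw]
  simp only [hc]
  have hG := Real.Gamma_pos_of_pos (show 0 < ρ * k + μ by linarith [hp k])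
  have hG' : ((Real.Gamma (ρ * k + μ) : ℝ) : ℂ) ≠ 0 := Complex.ofReal_ne_zero.mpr hG.ne'
  rw [Complex.Gamma_ofReal]
  have e1 : w ^ (-((ρ * k + μ : ℝ) : ℂ)) = (w ^ (-(ρ : ℂ))) ^ k * w ^ (-(μ : ℂ)) := by
    rw [← Complex.cpow_nat_mul, ← Complex.cpow_add _ _ hw0]
    push_cast
    ring_nf
  rw [e1]
  have : (k.factorial : ℂ) ≠ 0 := Nat.cast_ne_zero.mpr k.factorial_ne_zero
  field_simp
  ring

theorem exp_neg_le_rpow {p y : ℝ} (hp : 0 < p) (hy : 0 < y) : Real.exp (-y) ≤ (p / y) ^ p := by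
  have h1 : y / p ≤ Real.exp (y / p) := by linarith [Real.add_one_le_exp (y / p)]
  have h2 : (y / p) ^ p ≤ Real.exp y := by
    calc (y / p) ^ p ≤ Real.exp (y / p) ^ p := Real.rpow_le_rpow (by positivity) h1 hp.le
      _ = Real.exp y := by rw [← Real.exp_mul, div_mul_cancel₀ _ hp.ne']
  rw [Real.exp_neg, ← inv_div y p, Real.inv_rpow (by positivity)]
  exact inv_anti₀ (by positivity) h2

theorem arg_bounds_of_re_pos {w : ℂ} (hw : 0 < w.re) :
    -(Real.pi / 2) < w.arg ∧ w.arg < Real.pi / 2 :=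
  abs_lt.mp (Complex.abs_arg_lt_pi_div_two_iff.mpr (Or.inl hw))

theorem cos_mul_norm_rpow_le_re_cpow {ρ : ℝ} (hρ : 0 < ρ) (hρ1 : ρ < 1) {w : ℂ}
    (hw : 0 < w.re) :
    Real.cos (ρ * (Real.pi / 2)) * ‖w‖ ^ (-ρ) ≤ (w ^ (-(ρ : ℂ))).re := by
  have hw0 : w ≠ 0 := by rintro rfl; simp at hw
  have hn : 0 < ‖w‖ := norm_pos_iff.mpr hw0
  have h := arg_bounds_of_re_pos hw
  have hpi := Real.pi_pos
  rw [Complex.cpow_def_of_ne_zero hw0, Complex.exp_re]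
  have h1 : (Complex.log w * -(ρ : ℂ)).re = Real.log ‖w‖ * (-ρ) := by simp [Complex.log_re]
  have h2 : (Complex.log w * -(ρ : ℂ)).im = -(w.arg * ρ) := by simp [Complex.log_im]
  rw [h1, h2, ← Real.rpow_def_of_pos hn, mul_comm, Real.cos_neg, ← Real.cos_abs (w.arg * ρ)]
  refine mul_le_mul_of_nonneg_left ?_ (by positivity)
  refine Real.cos_le_cos_of_nonneg_of_le_pi (abs_nonneg _) (by nlinarith) ?_
  rw [abs_mul, abs_of_pos hρ, mul_comm]
  exact mul_le_mul_of_nonneg_left (abs_lt.mpr h).le hρ.le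

theorem re_cpow_neg_pos {ρ : ℝ} (hρ : 0 < ρ) (hρ1 : ρ < 1) {w : ℂ} (hw : 0 < w.re) :
    0 < (w ^ (-(ρ : ℂ))).re := by
  have hw0 : w ≠ 0 := by rintro rfl; simp at hw
  have hpi := Real.pi_pos
  refine lt_of_lt_of_le ?_ (cos_mul_norm_rpow_le_re_cpow hρ hρ1 hw)
  have := Real.cos_pos_of_mem_Ioo (x := ρ * (Real.pi / 2)) ⟨by nlinarith, by nlinarith⟩
  have := norm_pos_iff.mpr hw0
  positivity

theorem norm_exp_neg_mul_cpow_le {ρ p r : ℝ} (hρ : 0 < ρ) (hρ1 : ρ < 1) (hp : 0 < p) (hr : 0 < r)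
    {w : ℂ} (hw : 0 < w.re) :
    ‖Complex.exp (-(r : ℂ) * w ^ (-(ρ : ℂ)))‖ ≤
      (p / Real.cos (ρ * (Real.pi / 2))) ^ p * r ^ (-p) * ‖w‖ ^ (ρ * p) := by
  have hw0 : w ≠ 0 := by rintro rfl; simp at hw
  have hn : 0 < ‖w‖ := norm_pos_iff.mpr hw0
  have hpi := Real.pi_pos
  have hk : 0 < Real.cos (ρ * (Real.pi / 2)) :=
    Real.cos_pos_of_mem_Ioo ⟨by nlinarith, by nlinarith⟩
  have h1 : (-(r : ℂ) * w ^ (-(ρ : ℂ))).re = -(r * (w ^ (-(ρ : ℂ))).re) := by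
    simp
  have h2 := cos_mul_norm_rpow_le_re_cpow hρ hρ1 hw
  set κ := Real.cos (ρ * (Real.pi / 2))
  rw [Complex.norm_exp, h1]
  calc Real.exp (-(r * (w ^ (-(ρ : ℂ))).re)) ≤ Real.exp (-(r * (κ * ‖w‖ ^ (-ρ)))) := by
        apply Real.exp_le_exp.mpr
        exact neg_le_neg (mul_le_mul_of_nonneg_left h2 hr.le)
    _ ≤ (p / (r * (κ * ‖w‖ ^ (-ρ)))) ^ p := exp_neg_le_rpow hp (by positivity)
    _ = (p / κ * (r⁻¹ * ‖w‖ ^ ρ)) ^ p := by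
        rw [Real.rpow_neg hn.le]
        congr 1
        field_simp
    _ = _ := by
        rw [Real.mul_rpow (by positivity) (by positivity),
          Real.mul_rpow (by positivity) (by positivity), Real.inv_rpow hr.le,
          ← Real.rpow_neg hr.le, ← Real.rpow_mul hn.le, mul_assoc]

theorem norm_one_add_rpow_le {q : ℝ} (hq : 0 < q) (ξ : ℝ) :
    ‖(1 : ℂ) + 2 * Real.pi * ξ * Complex.I‖ ^ (-q) ≤ (1 + ‖ξ‖ ^ 2) ^ (-q / 2) := by
  have h1 : ‖(1 : ℂ) + 2 * Real.pi * ξ * Complex.I‖ = Real.sqrt (1 + (2 * Real.pi * ξ) ^ 2) := by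
    have := Complex.norm_add_mul_I 1 (2 * Real.pi * ξ)
    push_cast at this
    rw [this, one_pow]
  rw [h1, Real.sqrt_eq_rpow, ← Real.rpow_mul (by positivity)]
  have h2 : (1 : ℝ) / 2 * -q = -q / 2 := by ring
  rw [h2]
  refine Real.rpow_le_rpow_of_nonpos (by positivity) ?_ (by linarith)
  rw [Real.norm_eq_abs, sq_abs]
  have : 1 ≤ (2 * Real.pi) ^ 2 := by nlinarith [Real.pi_gt_three]
  nlinarith [sq_nonneg ξ]

/-- Algebraic decay of the Wright function on the negative half-line, obtained by Fourier
inversion of its Laplace transform. -/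
theorem exists_norm_wright_le_of_lt_sub_one {ρ μ p : ℝ} (hρ : 0 < ρ) (hρ1 : ρ < 1) (hp : 0 < p)
    (hpμ : ρ * p < μ - 1) :
    ∃ C : ℝ, ∀ r : ℝ, 0 < r → ‖wright ρ (μ : ℂ) (-(r : ℂ))‖ ≤ C * r ^ (-p) := by
  have hμ : 1 ≤ μ := by nlinarith
  set D := (p / Real.cos (ρ * (Real.pi / 2))) ^ p with hD
  set q := μ - ρ * p with hq
  have hq1 : 1 < q := by linarith
  set I := ∫ ξ : ℝ, (1 + ‖ξ‖ ^ 2) ^ (-q / 2)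
  have hI : Integrable fun ξ : ℝ => (1 + ‖ξ‖ ^ 2) ^ (-q / 2) :=
    integrable_rpow_neg_one_add_norm_sq (by simpa using hq1)
  refine ⟨Real.exp 1 * (D * I), fun r hr => ?_⟩
  set l : ℝ → ℂ := fun ξ => 1 + 2 * Real.pi * ξ * Complex.I with hl
  have hlre : ∀ ξ, 0 < (l ξ).re := fun ξ => by simp [hl]
  set H : ℝ → ℂ := fun ξ =>
    (l ξ) ^ (-(μ : ℂ)) * Complex.exp (-(r : ℂ) * (l ξ) ^ (-(ρ : ℂ))) with hH
  set g : ℝ → ℂ := (Ioi 0).indicator fun s : ℝ => Complex.exp (-1 * s) * (((s ^ (μ - 1) : ℝ) : ℂ) *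
    wright ρ (μ : ℂ) (-(r : ℂ) * ((s ^ ρ : ℝ) : ℂ))) with hg
  have hgint : Integrable g :=
    (integrable_indicator_iff measurableSet_Ioi).mpr
      (laplace_wright hρ hμ (-(r : ℂ)) (w := 1) (by simp)).1
  have hFg : FourierTransform.fourier g = H := by
    funext ξ
    rw [Real.fourier_eq']
    have e : (fun v : ℝ => Complex.exp (((-2 * Real.pi * inner ℝ v ξ : ℝ) : ℂ) * Complex.I) • g v) =
        (Ioi 0).indicator fun s : ℝ => Complex.exp (-(l ξ) * s) * (((s ^ (μ - 1) : ℝ) : ℂ) *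
          wright ρ (μ : ℂ) (-(r : ℂ) * ((s ^ ρ : ℝ) : ℂ))) := by
      funext v
      by_cases hv : v ∈ Ioi (0 : ℝ)
      · rw [hg, indicator_of_mem hv, indicator_of_mem hv, smul_eq_mul, ← mul_assoc,
          ← Complex.exp_add]
        congr 2
        simp [hl]
        ring
      · rw [hg, indicator_of_notMem hv, indicator_of_notMem hv, smul_zero]
    rw [e, integral_indicator measurableSet_Ioi]
    exact (laplace_wright hρ hμ (-(r : ℂ)) (hlre ξ)).2
  have hlc : Continuous l := by fun_prop
  have hHc : Continuous H := by
    refine Continuous.mul ?_ (Complex.continuous_exp.comp (continuous_const.mul ?_))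
    · exact hlc.cpow continuous_const fun ξ => Or.inl (hlre ξ)
    · exact hlc.cpow continuous_const fun ξ => Or.inl (hlre ξ)
  have hHb : ∀ ξ, ‖H ξ‖ ≤ D * r ^ (-p) * (1 + ‖ξ‖ ^ 2) ^ (-q / 2) := fun ξ => by
    have hl0 : l ξ ≠ 0 := fun h => by have := hlre ξ; simp [h] at this
    have hn : 0 < ‖l ξ‖ := norm_pos_iff.mpr hl0
    have h1 := norm_exp_neg_mul_cpow_le hρ hρ1 hp hr (hlre ξ)
    have h2 : ‖(l ξ) ^ (-(μ : ℂ))‖ = ‖l ξ‖ ^ (-μ) := by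
      rw [Complex.norm_cpow_of_ne_zero hl0]
      simp
    have hDr : 0 ≤ D * r ^ (-p) := by
      have hk : 0 ≤ Real.cos (ρ * (Real.pi / 2)) :=
        Real.cos_nonneg_of_mem_Icc ⟨by nlinarith [Real.pi_pos], by nlinarith [Real.pi_pos]⟩
      positivity
    rw [hH, norm_mul, h2]
    calc ‖l ξ‖ ^ (-μ) * ‖Complex.exp (-(r : ℂ) * (l ξ) ^ (-(ρ : ℂ)))‖
        ≤ ‖l ξ‖ ^ (-μ) * (D * r ^ (-p) * ‖l ξ‖ ^ (ρ * p)) := by gcongr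
      _ = D * r ^ (-p) * ‖l ξ‖ ^ (-q) := by
          have : -q = -μ + ρ * p := by rw [hq]; ring
          rw [this, Real.rpow_add hn]
          ring
      _ ≤ _ := mul_le_mul_of_nonneg_left (norm_one_add_rpow_le (by linarith) ξ) hDr
  have hHint : Integrable H :=
    Integrable.mono' (hI.const_mul _) hHc.aestronglyMeasurable (Filter.Eventually.of_forall hHb)
  have hcont : ContinuousAt g 1 := by
    have h1 : ContinuousOn (fun s : ℝ => Complex.exp (-1 * s) * (((s ^ (μ - 1) : ℝ) : ℂ) *
        wright ρ (μ : ℂ) (-(r : ℂ) * ((s ^ ρ : ℝ) : ℂ)))) (Ioi 0) := by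
      have hc : ∀ a : ℝ, ContinuousOn (fun s : ℝ => ((s ^ a : ℝ) : ℂ)) (Ioi 0) := fun a =>
        Complex.continuous_ofReal.comp_continuousOn
          (continuousOn_id.rpow_const fun t ht => Or.inl (ne_of_gt ht))
      refine ContinuousOn.mul (by fun_prop) ((hc _).mul ?_)
      exact (continuous_wright hρ.le hμ).comp_continuousOn (continuousOn_const.mul (hc _))
    refine (h1.continuousAt (Ioi_mem_nhds one_pos)).congr ?_
    filter_upwards [Ioi_mem_nhds (show (0 : ℝ) < 1 from one_pos)] with s hs
    rw [hg, indicator_of_mem hs]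
  have hinv := hgint.fourierInv_fourier_eq (by rw [hFg]; exact hHint) hcont
  rw [hFg, Real.fourierInv_eq', hg, indicator_of_mem (mem_Ioi.mpr (one_pos (α := ℝ)))] at hinv
  simp only [Real.one_rpow, Complex.ofReal_one, mul_one, one_mul] at hinv
  have h3 : ‖Complex.exp (-1) * wright ρ (μ : ℂ) (-(r : ℂ))‖ ≤ D * r ^ (-p) * I := by
    rw [← hinv]
    refine (norm_integral_le_of_norm_le (hI.const_mul (D * r ^ (-p)))
      (Filter.Eventually.of_forall fun ξ => ?_)).trans (integral_const_mul _ _).le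
    rw [norm_smul, Complex.norm_exp_ofReal_mul_I, one_mul]
    exact hHb ξ
  rw [norm_mul, Complex.norm_exp] at h3
  have h4 : Real.exp 1 * Real.exp (-1 : ℂ).re = 1 := by
    rw [← Real.exp_add]
    simp
  calc ‖wright ρ (μ : ℂ) (-(r : ℂ))‖
      = Real.exp 1 * (Real.exp (-1 : ℂ).re * ‖wright ρ (μ : ℂ) (-(r : ℂ))‖) := by
        rw [← mul_assoc, h4, one_mul]
    _ ≤ Real.exp 1 * (D * r ^ (-p) * I) := mul_le_mul_of_nonneg_left h3 (Real.exp_pos _).le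
    _ = _ := by ring

theorem exists_norm_wright_le {ρ μ p : ℝ} (hρ : 0 < ρ) (hρ1 : ρ < 1) (hμ : 1 ≤ μ) (hp : 0 < p)
    (hpμ : ρ * p < μ) :
    ∃ C : ℝ, ∀ r : ℝ, 0 < r → ‖wright ρ (μ : ℂ) (-(r : ℂ))‖ ≤ C * r ^ (-p) := by
  obtain ⟨C₁, h₁⟩ := exists_norm_wright_le_of_lt_sub_one (μ := μ + 1) hρ hρ1 hp (by linarith)
  obtain ⟨C₂, h₂⟩ := exists_norm_wright_le_of_lt_sub_one (μ := μ + 1 + ρ) (p := p + 1) hρ hρ1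
    (by linarith) (by linarith)
  refine ⟨μ * C₁ + ρ * C₂, fun r hr => ?_⟩
  rw [wright_recurrence hρ.le hμ]
  refine (norm_add_le _ _).trans ?_
  rw [norm_mul, norm_mul, norm_mul, norm_neg, Complex.norm_real, Complex.norm_real,
    Complex.norm_real, Real.norm_of_nonneg hρ.le, Real.norm_of_nonneg hr.le,
    Real.norm_of_nonneg (by linarith)]
  have e : r * r ^ (-(p + 1)) = r ^ (-p) := by
    nth_rewrite 1 [← Real.rpow_one r]
    rw [← Real.rpow_add hr]
    ring_nf
  calc _ ≤ μ * (C₁ * r ^ (-p)) + ρ * r * (C₂ * r ^ (-(p + 1))) := by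
        gcongr
        · exact h₁ r hr
        · exact h₂ r hr
    _ = μ * C₁ * r ^ (-p) + ρ * C₂ * (r * r ^ (-(p + 1))) := by ring
    _ = _ := by rw [e]; ring

theorem integrableOn_norm_wright_mul_rpow {ρ b : ℝ} (hρ : 0 < ρ) (hρ1 : ρ < 1) (hb : 0 ≤ b) :
    IntegrableOn (fun u : ℝ => ‖wright ρ ((1 + ρ * (1 + b) : ℝ) : ℂ) (-(u : ℂ))‖ * u ^ b)
      (Ioi 0) := by
  have hμ : 1 ≤ 1 + ρ * (1 + b) := by nlinarith
  have hc : ContinuousOn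
      (fun u : ℝ => ‖wright ρ ((1 + ρ * (1 + b) : ℝ) : ℂ) (-(u : ℂ))‖ * u ^ b) (Ici 0) := by
    refine ContinuousOn.mul ?_ (continuousOn_id.rpow_const fun t _ => Or.inr hb)
    exact ((continuous_wright hρ.le hμ).comp (by fun_prop)).norm.continuousOn
  obtain ⟨C, hC⟩ := exists_norm_wright_le (μ := 1 + ρ * (1 + b)) (p := b + 2) hρ hρ1 hμ
    (by linarith) (by nlinarith)
  rw [← Ioc_union_Ioi_eq_Ioi (zero_le_one (α := ℝ))]
  refine IntegrableOn.union ?_ ?_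
  · exact ((hc.mono Icc_subset_Ici_self).integrableOn_Icc).mono_set Ioc_subset_Icc_self
  · refine Integrable.mono' ((integrableOn_Ioi_rpow_of_lt (a := -2) (by norm_num)
      one_pos).const_mul C) ((hc.mono fun u hu => ?_).aestronglyMeasurable measurableSet_Ioi) ?_
    · exact (zero_lt_one.trans (mem_Ioi.mp hu)).le
    · filter_upwards [ae_restrict_mem measurableSet_Ioi] with u hu
      have hu' : 0 < u := zero_lt_one.trans (mem_Ioi.mp hu)
      rw [norm_mul, norm_norm, Real.norm_of_nonneg (by positivity)]
      calc _ ≤ C * u ^ (-(b + 2)) * u ^ b := by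
            gcongr
            exact hC u hu'
        _ = C * u ^ (-2 : ℝ) := by
            rw [mul_assoc, ← Real.rpow_add hu']
            ring_nf

theorem integrableOn_norm_wright_comp_mul_rpow {ρ b c : ℝ} (hρ : 0 < ρ) (hρ1 : ρ < 1) (hb : 0 ≤ b)
    (hc : 0 < c) :
    IntegrableOn (fun s : ℝ =>
      ‖wright ρ ((1 + ρ * (1 + b) : ℝ) : ℂ) (-((s : ℂ) * (c : ℂ)))‖ * s ^ b) (Ioi 0) ∧
    ∫ s in Ioi (0 : ℝ), ‖wright ρ ((1 + ρ * (1 + b) : ℝ) : ℂ) (-((s : ℂ) * (c : ℂ)))‖ * s ^ b =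
      c ^ (-(1 + b)) *
        ∫ u in Ioi (0 : ℝ), ‖wright ρ ((1 + ρ * (1 + b) : ℝ) : ℂ) (-(u : ℂ))‖ * u ^ b := by
  set h : ℝ → ℝ := fun u => ‖wright ρ ((1 + ρ * (1 + b) : ℝ) : ℂ) (-(u : ℂ))‖ * u ^ b with hh
  have heq : EqOn (fun s : ℝ =>
      ‖wright ρ ((1 + ρ * (1 + b) : ℝ) : ℂ) (-((s : ℂ) * (c : ℂ)))‖ * s ^ b)
      (fun s => c ^ (-b) * h (c * s)) (Ioi 0) := by
    intro s hs
    have hs' : 0 < s := hs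
    simp only [hh]
    rw [Real.mul_rpow hc.le hs'.le, Real.rpow_neg hc.le, mul_comm c s]
    push_cast
    have : c ^ b ≠ 0 := (Real.rpow_pos_of_pos hc b).ne'
    field_simp
  have h1 : IntegrableOn (fun s => h (c * s)) (Ioi 0) := by
    rw [integrableOn_Ioi_comp_mul_left_iff h 0 hc, mul_zero]
    exact integrableOn_norm_wright_mul_rpow hρ hρ1 hb
  refine ⟨IntegrableOn.congr_fun (h1.const_mul (c ^ (-b))) heq.symm measurableSet_Ioi, ?_⟩
  rw [setIntegral_congr_fun measurableSet_Ioi heq, integral_const_mul,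
    integral_comp_mul_left_Ioi h 0 hc, mul_zero, smul_eq_mul, ← mul_assoc]
  congr 1
  rw [neg_add, Real.rpow_add hc, Real.rpow_neg_one, mul_comm]

theorem integrableOn_wright_smul {E : Type*} [NormedAddCommGroup E] [NormedSpace ℂ E]
    {ρ b c K : ℝ} (hρ : 0 < ρ) (hρ1 : ρ < 1) (hb : 0 ≤ b) (hc : 0 < c)
    {f : ℝ → E} (hf : ContinuousOn f (Ioi 0)) (hK : ∀ s, 0 < s → ‖f s‖ ≤ K * s ^ b) :
    IntegrableOn (fun s : ℝ =>
      wright ρ ((1 + ρ * (1 + b) : ℝ) : ℂ) (-((s : ℂ) * (c : ℂ))) • f s) (Ioi 0) ∧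
    ∫ s in Ioi (0 : ℝ),
      ‖wright ρ ((1 + ρ * (1 + b) : ℝ) : ℂ) (-((s : ℂ) * (c : ℂ))) • f s‖ ≤
      K * (c ^ (-(1 + b)) *
        ∫ u in Ioi (0 : ℝ), ‖wright ρ ((1 + ρ * (1 + b) : ℝ) : ℂ) (-(u : ℂ))‖ * u ^ b) := by
  have hμ : 1 ≤ 1 + ρ * (1 + b) := by nlinarith
  obtain ⟨h1, h2⟩ := integrableOn_norm_wright_comp_mul_rpow hρ hρ1 hb hc
  have hle : ∀ s ∈ Ioi (0 : ℝ),
      ‖wright ρ ((1 + ρ * (1 + b) : ℝ) : ℂ) (-((s : ℂ) * (c : ℂ))) • f s‖ ≤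
      K * (‖wright ρ ((1 + ρ * (1 + b) : ℝ) : ℂ) (-((s : ℂ) * (c : ℂ)))‖ * s ^ b) := by
    intro s hs
    rw [norm_smul, mul_left_comm]
    exact mul_le_mul_of_nonneg_left (hK s hs) (norm_nonneg _)
  have hi : IntegrableOn (fun s : ℝ =>
      wright ρ ((1 + ρ * (1 + b) : ℝ) : ℂ) (-((s : ℂ) * (c : ℂ))) • f s) (Ioi 0) := by
    refine Integrable.mono' (h1.const_mul K) ?_ ?_
    · refine ContinuousOn.aestronglyMeasurable (ContinuousOn.smul ?_ hf) measurableSet_Ioi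
      exact ((continuous_wright hρ.le hμ).comp (by fun_prop)).continuousOn
    · filter_upwards [ae_restrict_mem measurableSet_Ioi] with s hs using hle s hs
  refine ⟨hi, ?_⟩
  rw [← h2, ← integral_const_mul]
  exact setIntegral_mono_on hi.norm (h1.const_mul K) measurableSet_Ioi hle

theorem rpow_mul_rpow_rpow_neg {ρ b t : ℝ} (ht : 0 < t) :
    t ^ (ρ * (1 + b)) * (t ^ ρ) ^ (-(1 + b)) = 1 := by
  rw [← Real.rpow_mul ht.le, ← Real.rpow_add ht]
  ring_nf
  exact Real.rpow_zero t

/-- Subordination: the Wright transform of `f` is bounded and its Laplace transform is an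
evaluation of the Laplace transform of `f` at `l ^ (-ρ)`. -/
theorem laplace_wright_transform {E : Type*} [NormedAddCommGroup E] [NormedSpace ℂ E]
    [CompleteSpace E] {ρ b K : ℝ} (hρ : 0 < ρ) (hρ1 : ρ < 1) (hb : 0 ≤ b)
    {f : ℝ → E} (hf : ContinuousOn f (Ioi 0)) (hK : ∀ s, 0 < s → ‖f s‖ ≤ K * s ^ b)
    {l : ℂ} (hl : 0 < l.re) :
    IntegrableOn (fun t : ℝ => Complex.exp (-l * t) • ((t ^ (ρ * (1 + b)) : ℝ) •
      ∫ s in Ioi (0 : ℝ), wright ρ ((1 + ρ * (1 + b) : ℝ) : ℂ)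
        (-((s : ℂ) * ((t ^ ρ : ℝ) : ℂ))) • f s)) (Ioi 0) ∧
    ∫ t in Ioi (0 : ℝ), Complex.exp (-l * t) • ((t ^ (ρ * (1 + b)) : ℝ) •
      ∫ s in Ioi (0 : ℝ), wright ρ ((1 + ρ * (1 + b) : ℝ) : ℂ)
        (-((s : ℂ) * ((t ^ ρ : ℝ) : ℂ))) • f s) =
      l ^ (-((1 + ρ * (1 + b) : ℝ) : ℂ)) •
        ∫ s in Ioi (0 : ℝ), Complex.exp (-(l ^ (-(ρ : ℂ))) * s) • f s := by
  set μ := 1 + ρ * (1 + b) with hμdef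
  have hμ : 1 ≤ μ := by nlinarith
  set W := ∫ u in Ioi (0 : ℝ), ‖wright ρ (μ : ℂ) (-(u : ℂ))‖ * u ^ b
  set g : ℝ → ℝ → E := fun t s =>
    (Complex.exp (-l * t) * (((t ^ (ρ * (1 + b)) : ℝ) : ℂ) *
      wright ρ (μ : ℂ) (-((s : ℂ) * ((t ^ ρ : ℝ) : ℂ))))) • f s with hg
  have hg' : ∀ t s, g t s = (Complex.exp (-l * t) * ((t ^ (ρ * (1 + b)) : ℝ) : ℂ)) •
      (wright ρ (μ : ℂ) (-((s : ℂ) * ((t ^ ρ : ℝ) : ℂ))) • f s) := fun t s => by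
    simp only [hg, smul_smul, mul_assoc]
  have hinner : ∀ t : ℝ, ∫ s in Ioi (0 : ℝ), g t s =
      Complex.exp (-l * t) • ((t ^ (ρ * (1 + b)) : ℝ) •
      ∫ s in Ioi (0 : ℝ), wright ρ (μ : ℂ) (-((s : ℂ) * ((t ^ ρ : ℝ) : ℂ))) • f s) := fun t => by
    simp_rw [hg']
    rw [integral_smul, mul_smul, Complex.coe_smul]
  have hgm : AEStronglyMeasurable (Function.uncurry g)
      ((volume.restrict (Ioi 0)).prod (volume.restrict (Ioi 0))) := by
    rw [Measure.prod_restrict]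
    refine ContinuousOn.aestronglyMeasurable ?_ (measurableSet_Ioi.prod measurableSet_Ioi)
    have hc : ∀ a : ℝ, ContinuousOn (fun p : ℝ × ℝ => ((p.1 ^ a : ℝ) : ℂ))
        (Ioi (0 : ℝ) ×ˢ Ioi (0 : ℝ)) := fun a =>
      Complex.continuous_ofReal.comp_continuousOn
        (continuousOn_fst.rpow_const fun p hp => Or.inl (ne_of_gt hp.1))
    refine ContinuousOn.smul (ContinuousOn.mul (by fun_prop) ((hc _).mul ?_))
      (hf.comp continuousOn_snd fun p hp => hp.2)
    refine (continuous_wright hρ.le hμ).comp_continuousOn (ContinuousOn.neg ?_)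
    exact ContinuousOn.mul (by fun_prop) (hc _)
  have hint : Integrable (Function.uncurry g)
      ((volume.restrict (Ioi 0)).prod (volume.restrict (Ioi 0))) := by
    rw [integrable_prod_iff hgm]
    refine ⟨?_, ?_⟩
    · filter_upwards [ae_restrict_mem measurableSet_Ioi] with t ht
      simp only [Function.uncurry_apply_pair, hg']
      exact (integrableOn_wright_smul hρ hρ1 hb (Real.rpow_pos_of_pos ht ρ) hf hK).1.smul _
    · refine Integrable.mono' (g := fun t : ℝ => K * W * (t ^ (0 : ℝ) * Real.exp (-l.re * t)))
        ((integrableOn_rpow_mul_exp_neg_mul_Ioi (by norm_num) hl).const_mul _)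
        hgm.norm.integral_prod_right' ?_
      filter_upwards [ae_restrict_mem measurableSet_Ioi] with t ht
      have ht' : 0 < t := ht
      rw [Real.norm_of_nonneg (integral_nonneg fun s => norm_nonneg _)]
      simp only [Function.uncurry_apply_pair, hg']
      simp_rw [norm_smul (Complex.exp (-l * t) * ((t ^ (ρ * (1 + b)) : ℝ) : ℂ))]
      rw [integral_const_mul, norm_mul, Complex.norm_exp, Complex.norm_real,
        Real.norm_of_nonneg (by positivity), Real.rpow_zero, one_mul]
      have h1 : (-l * (t : ℂ)).re = -l.re * t := by simp
      rw [h1]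
      have h2 := (integrableOn_wright_smul hρ hρ1 hb (Real.rpow_pos_of_pos ht' ρ) hf hK).2
      calc _ ≤ Real.exp (-l.re * t) * t ^ (ρ * (1 + b)) *
            (K * ((t ^ ρ) ^ (-(1 + b)) * W)) := by
            gcongr
        _ = Real.exp (-l.re * t) * K * W *
            (t ^ (ρ * (1 + b)) * (t ^ ρ) ^ (-(1 + b))) := by ring
        _ = _ := by rw [rpow_mul_rpow_rpow_neg ht']; ring
  refine ⟨(integrable_congr (Filter.Eventually.of_forall hinner)).mp hint.integral_prod_left, ?_⟩
  simp_rw [← hinner]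
  rw [integral_integral_swap hint, ← integral_smul]
  refine setIntegral_congr_fun measurableSet_Ioi fun s hs => ?_
  simp only [hg]
  rw [integral_smul_const, smul_smul]
  congr 1
  have h := (laplace_wright hρ hμ (-(s : ℂ)) hl).2
  have h3 : μ - 1 = ρ * (1 + b) := by rw [hμdef]; ring
  rw [h3] at h
  simp_rw [neg_mul (s : ℂ)] at h
  rw [neg_mul (l ^ (-(ρ : ℂ))), mul_comm (l ^ (-(ρ : ℂ))) (s : ℂ), ← h]

theorem IsResolventOf.eq_of_isResolventOf {A : X →ₗ.[ℂ] X} {z₀ z₁ : ℂ} {R₀ R₁ : X →L[ℂ] X}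
    (h₀ : IsResolventOf A z₀ R₀) (h₁ : IsResolventOf A z₁ R₁) (x : X) :
    R₁ x = R₀ (x + (z₀ - z₁) • R₁ x) := by
  have h := h₀.left ⟨R₁ x, h₁.mem x⟩
  have h2 : x + (z₀ - z₁) • R₁ x = z₀ • R₁ x - A ⟨R₁ x, h₁.mem x⟩ := by
    nth_rewrite 1 [← h₁.right x]
    rw [sub_smul]
    abel
  rw [h2]
  exact h.symm

/-- An operator satisfying the resolvent identity with a genuine resolvent, and the left inverse
identity, is a resolvent. -/
theorem IsResolventOf.of_resolvent_identity {A : X →ₗ.[ℂ] X} {z₀ z : ℂ} {R₀ R : X →L[ℂ] X}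
    (h₀ : IsResolventOf A z₀ R₀) (hr : ∀ x, R x = R₀ (x + (z₀ - z) • R x))
    (hl : ∀ y : A.domain, R (z • (y : X) - A y) = y) : IsResolventOf A z R := by
  have hm : ∀ x, R x ∈ A.domain := fun x => by
    rw [hr x]
    exact h₀.mem _
  refine ⟨hm, fun x => ?_, hl⟩
  have h1 := h₀.right (x + (z₀ - z) • R x)
  have h2 : (⟨R₀ (x + (z₀ - z) • R x), h₀.mem _⟩ : A.domain) = ⟨R x, hm x⟩ :=
    Subtype.ext (hr x).symm
  rw [h2, ← hr x, sub_smul] at h1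
  have h3 : z • R x - A ⟨R x, hm x⟩ =
      (z₀ • R x - A ⟨R x, hm x⟩) - (z₀ • R x - z • R x) := by abel
  rw [h3, h1]
  abel

/-- `(z - A⁻¹)⁻¹ = z⁻¹ - z⁻² (z⁻¹ - A)⁻¹`. -/
theorem IsResolventOf.inverse {A B : X →ₗ.[ℂ] X} (hB : IsInverseOf B A) {z : ℂ} (hz : z ≠ 0)
    {R : X →L[ℂ] X} (h : IsResolventOf A z⁻¹ R) :
    IsResolventOf B z (z⁻¹ • ContinuousLinearMap.id ℂ X - (z⁻¹ * z⁻¹) • R) := by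
  have e : ∀ x, (z⁻¹ • ContinuousLinearMap.id ℂ X - (z⁻¹ * z⁻¹) • R) x =
      (-z⁻¹) • A ⟨R x, h.mem x⟩ := fun x => by
    have h1 : A ⟨R x, h.mem x⟩ = z⁻¹ • R x - x := by
      rw [eq_sub_iff_add_eq, add_comm, ← eq_sub_iff_add_eq]
      exact (h.right x).symm
    rw [h1]
    simp only [sub_apply, smul_apply,
      ContinuousLinearMap.id_apply]
    module
  have hm : ∀ x, (z⁻¹ • ContinuousLinearMap.id ℂ X - (z⁻¹ * z⁻¹) • R) x ∈ B.domain := fun x => by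
    rw [e]
    exact B.domain.smul_mem _ (hB.1 ⟨R x, h.mem x⟩).1
  refine ⟨hm, fun x => ?_, fun y => ?_⟩
  · obtain ⟨h1, h2⟩ := hB.1 ⟨R x, h.mem x⟩
    have h3 : (⟨_, hm x⟩ : B.domain) = (-z⁻¹) • ⟨A ⟨R x, h.mem x⟩, h1⟩ := Subtype.ext (e x)
    rw [h3, LinearPMap.map_smul, h2]
    simp only [sub_apply, smul_apply,
      ContinuousLinearMap.id_apply, smul_sub, smul_smul, mul_inv_cancel₀ hz, one_smul,
      mul_inv_cancel_left₀ hz, neg_smul]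
    abel
  · obtain ⟨h1, h2⟩ := hB.2 y
    have h3 := h.left ⟨B y, h1⟩
    rw [h2] at h3
    have h4 : z • (y : X) - B y = (-z) • (z⁻¹ • B y - (y : X)) := by
      rw [smul_sub, smul_smul, neg_mul, mul_inv_cancel₀ hz]
      module
    have h5 : R (z • (y : X) - B y) = (-z) • B y := by
      rw [h4, map_smul, h3]
    simp only [sub_apply, smul_apply,
      ContinuousLinearMap.id_apply]
    rw [h5, smul_sub, smul_smul, smul_smul, inv_mul_cancel₀ hz, mul_assoc, mul_neg,
      inv_mul_cancel₀ hz]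
    module

theorem IsTemperedROF.norm_apply_le {A : X →ₗ.[ℂ] X} {α β M : ℝ} {S : ℝ → X →L[ℂ] X}
    (hS : IsTemperedROF A α β S M) (x : X) (t : ℝ) (ht : 0 < t) :
    ‖S t x‖ ≤ M * ‖x‖ * t ^ β := by
  refine ((S t).le_of_opNorm_le (hS.bound t ht.le) x).trans (le_of_eq ?_)
  ring

theorem IsTemperedROF.continuousOn {A : X →ₗ.[ℂ] X} {α β M : ℝ} {S : ℝ → X →L[ℂ] X}
    (hS : IsTemperedROF A α β S M) (x : X) : ContinuousOn (fun t => S t x) (Ioi 0) :=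
  (hS.cont x).mono Ioi_subset_Ici_self

/-- The Laplace transform of a tempered resolvent operator function, as a bounded operator. -/
theorem IsTemperedROF.exists_laplace_clm {A : X →ₗ.[ℂ] X} {α β M : ℝ} {S : ℝ → X →L[ℂ] X}
    (hβ : 0 ≤ β) (hS : IsTemperedROF A α β S M) {w : ℂ} (hw : 0 < w.re) :
    ∃ L : X →L[ℂ] X, ∀ x, L x = ∫ t in Ioi (0 : ℝ), Complex.exp (-w * t) • S t x := by
  have hi := fun x => integrableOn_laplace (b := β) (by linarith) (hS.continuousOn x)
    (hS.norm_apply_le x) hw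
  let T : X →ₗ[ℂ] X :=
    { toFun := fun x => ∫ t in Ioi (0 : ℝ), Complex.exp (-w * t) • S t x
      map_add' := fun x y => by
        simp_rw [map_add, smul_add]
        exact integral_add (hi x) (hi y)
      map_smul' := fun c x => by
        simp_rw [map_smul, smul_comm _ c]
        exact integral_smul c _ }
  refine ⟨T.mkContinuous (M * ∫ t in Ioi (0 : ℝ), t ^ β * Real.exp (-w.re * t)) fun x => ?_,
    fun x => rfl⟩
  have h := norm_integral_le_of_norm_le
    ((integrableOn_rpow_mul_exp_neg_mul_Ioi (b := β) (by linarith) hw).const_mul (M * ‖x‖))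
    (f := fun t : ℝ => Complex.exp (-w * t) • S t x) (by
      filter_upwards [ae_restrict_mem measurableSet_Ioi] with t ht
      have h1 : (-w * (t : ℂ)).re = -w.re * t := by simp
      rw [norm_smul, Complex.norm_exp, h1]
      refine (mul_le_mul_of_nonneg_left (hS.norm_apply_le x t ht) (Real.exp_pos _).le).trans
        (le_of_eq ?_)
      ring)
  rw [integral_const_mul] at h
  refine h.trans (le_of_eq ?_)
  ring

/-- The Laplace transform identity of a tempered resolvent operator function extends from the
positive half-line to the right half-plane. -/
theorem IsTemperedROF.laplace_complex [CompleteSpace X] {A : X →ₗ.[ℂ] X} {α β M : ℝ}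
    {S : ℝ → X →L[ℂ] X} (hβ : 0 ≤ β) (hS : IsTemperedROF A α β S M) {w : ℂ} (hw : 0 < w.re) :
    ∃ R : X →L[ℂ] X, IsResolventOf A (w ^ (α : ℂ)) R ∧
      ∀ x, R x = w ^ ((β + 1 - α : ℝ) : ℂ) •
        ∫ t in Ioi (0 : ℝ), Complex.exp (-w * t) • S t x := by
  set Q : X → ℂ → X := fun x w => w ^ ((β + 1 - α : ℝ) : ℂ) •
    ∫ t in Ioi (0 : ℝ), Complex.exp (-w * t) • S t x with hQ
  have hcpow : ∀ c : ℂ, DifferentiableOn ℂ (fun w : ℂ => w ^ c) {w | 0 < w.re} := fun c z hz =>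
    (differentiableAt_id.cpow_const (Or.inl hz)).differentiableWithinAt
  have hQd : ∀ x, DifferentiableOn ℂ (Q x) {w | 0 < w.re} := fun x =>
    (hcpow _).smul (differentiableOn_laplace (b := β) (by linarith) (hS.continuousOn x)
      (hS.norm_apply_le x))
  have hreal : ∀ r : ℝ, 0 < r → ∃ R : X →L[ℂ] X, IsResolventOf A ((r : ℂ) ^ (α : ℂ)) R ∧
      ∀ x, R x = Q x r := by
    intro r hr
    obtain ⟨R, hR, hRx⟩ := hS.laplace r hr
    refine ⟨R, ?_, fun x => ?_⟩
    · rwa [← Complex.ofReal_cpow hr.le]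
    · have h1 : ∫ t in Ioi (0 : ℝ), Complex.exp (-(r : ℂ) * t) • S t x =
          ((r ^ (α - β - 1) : ℝ) : ℂ) • R x := by
        rw [hRx x]
        refine setIntegral_congr_fun measurableSet_Ioi fun t _ => ?_
        rw [← Complex.coe_smul]
        push_cast
        ring_nf
      simp only [hQ]
      rw [h1, smul_smul, ← Complex.ofReal_cpow hr.le, ← Complex.ofReal_mul, ← Real.rpow_add hr]
      ring_nf
      simp
  obtain ⟨R₀, hR₀, -⟩ := hreal 1 one_pos
  obtain ⟨L, hL⟩ := hS.exists_laplace_clm hβ hw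
  refine ⟨w ^ ((β + 1 - α : ℝ) : ℂ) • L, ?_, fun x => by simp [hL]⟩
  have hQw : ∀ x, (w ^ ((β + 1 - α : ℝ) : ℂ) • L) x = Q x w := fun x => by simp [hQ, hL]
  refine hR₀.of_resolvent_identity (fun x => ?_) (fun y => ?_)
  · rw [hQw]
    refine eqOn_rightHalfPlane (hQd x) (g := fun w => R₀ (x +
      (((1 : ℝ) : ℂ) ^ (α : ℂ) - w ^ (α : ℂ)) • Q x w)) ?_ (fun r hr => ?_) hw
    · refine R₀.differentiable.comp_differentiableOn (DifferentiableOn.const_add _ ?_)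
      exact ((hcpow _).const_sub _).smul (hQd x)
    · obtain ⟨R, hR, hRx⟩ := hreal r hr
      simp only [← hRx x]
      exact hR₀.eq_of_isResolventOf hR x
  · rw [map_sub, map_smul, hQw, hQw]
    refine eqOn_rightHalfPlane (f := fun w => w ^ (α : ℂ) • Q (y : X) w - Q (A y) w)
      (g := fun _ => (y : X)) (((hcpow _).smul (hQd _)).sub (hQd _))
      (differentiableOn_const _) (fun r hr => ?_) hw
    obtain ⟨R, hR, hRx⟩ := hreal r hr
    simp only [← hRx]
    rw [← map_smul, ← map_sub]
    exact hR.left y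

/-- The Bochner integral vanishes in an incomplete space, so that only complete spaces carry a
tempered resolvent operator function. -/
theorem IsTemperedROF.completeSpace {A : X →ₗ.[ℂ] X} {α β M : ℝ} {S : ℝ → X →L[ℂ] X}
    (hS : IsTemperedROF A α β S M) : CompleteSpace X := by
  by_contra hX
  obtain ⟨R, hR, hRx⟩ := hS.laplace 1 one_pos
  have h0 : ∀ x, R x = 0 := fun x => by
    have := hRx x
    rw [integral_of_not_completeSpace hX] at this
    simpa using this
  have h1 : ∀ x : X, x = 0 := fun x => by
    have h2 : (⟨R x, hR.mem x⟩ : A.domain) = 0 := Subtype.ext (h0 x)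
    rw [← hR.right x, h2, h0 x, LinearPMap.map_zero]
    simp
  have : Subsingleton X := ⟨fun x y => (h1 x).trans (h1 y).symm⟩
  exact hX inferInstance

theorem cpow_neg_cpow {ρ : ℝ} (hρ : 0 < ρ) (hρ1 : ρ < 1) {l : ℂ} (hl : 0 < l.re) (c : ℂ) :
    (l ^ (-(ρ : ℂ))) ^ c = l ^ (-(ρ : ℂ) * c) := by
  have h := arg_bounds_of_re_pos hl
  have h2 : (Complex.log l * -(ρ : ℂ)).im = -(l.arg * ρ) := by simp [Complex.log_im]
  have hpi := Real.pi_pos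
  rw [Complex.cpow_mul]
  · rw [h2]; nlinarith
  · rw [h2]; nlinarith

theorem stmt17 {X : Type*} [NormedAddCommGroup X] [NormedSpace ℂ X]
    (A B : X →ₗ.[ℂ] X) (alpha beta gamma M : ℝ)
    (hgamma0 : 0 < gamma) (hga : gamma < alpha) (halpha2 : alpha ≤ 2) (hbeta : 0 ≤ beta)
    (hdom : Dense (A.domain : Set X))
    (hran : Dense (Set.range fun y : A.domain => A y))
    (hB : IsInverseOf B A)
    (S : ℝ → X →L[ℂ] X) (hS : IsTemperedROF A alpha beta S M) :
    ∃ F : ℝ → X → X,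
      (∀ t : ℝ, 0 < t → ∀ x : X,
        MeasureTheory.IntegrableOn
          (fun s : ℝ => wright (gamma / alpha) ((1 + gamma * (1 + beta) / alpha : ℝ) : ℂ)
            (-((s : ℂ) * ((t ^ (gamma / alpha) : ℝ) : ℂ))) • S s x)
          (Set.Ioi 0) ∧
        F t x = x - (t ^ (gamma * (1 + beta) / alpha) : ℝ) •
          ∫ s in Set.Ioi (0 : ℝ),
            wright (gamma / alpha) ((1 + gamma * (1 + beta) / alpha : ℝ) : ℂ)
              (-((s : ℂ) * ((t ^ (gamma / alpha) : ℝ) : ℂ))) • S s x) ∧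
      (∃ C : ℝ, ∀ t : ℝ, 0 < t → ∀ x : X, ‖F t x‖ ≤ C * ‖x‖) ∧
      (∀ l : ℂ, 0 < l.re → ∃ R : X →L[ℂ] X, IsResolventOf B (l ^ (gamma : ℂ)) R ∧
        ∀ x : X, l ^ ((gamma : ℂ) - 1) • R x =
          ∫ t in Set.Ioi (0 : ℝ), Complex.exp (-l * t) • F t x) := by
  have := hS.completeSpace
  have halpha : 0 < alpha := hgamma0.trans hga
  set ρ := gamma / alpha with hρdef
  have hρ : 0 < ρ := div_pos hgamma0 halpha
  have hρ1 : ρ < 1 := (div_lt_one halpha).mpr hga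
  have hγ : gamma = ρ * alpha := by rw [hρdef]; field_simp
  have hexp : gamma * (1 + beta) / alpha = ρ * (1 + beta) := by rw [hρdef]; ring
  rw [hexp]
  set μ := 1 + ρ * (1 + beta) with hμ
  set G : ℝ → X → X := fun t x => (t ^ (ρ * (1 + beta)) : ℝ) •
    ∫ s in Ioi (0 : ℝ), wright ρ (μ : ℂ) (-((s : ℂ) * ((t ^ ρ : ℝ) : ℂ))) • S s x with hG
  refine ⟨fun t x => x - G t x, fun t ht x => ⟨?_, rfl⟩, ?_, fun l hl => ?_⟩
  · exact (integrableOn_wright_smul hρ hρ1 hbeta (Real.rpow_pos_of_pos ht ρ)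
      (hS.continuousOn x) (hS.norm_apply_le x)).1
  · refine ⟨1 + M * ∫ u in Ioi (0 : ℝ), ‖wright ρ (μ : ℂ) (-(u : ℂ))‖ * u ^ beta,
      fun t ht x => ?_⟩
    have h1 := (integrableOn_wright_smul hρ hρ1 hbeta (Real.rpow_pos_of_pos ht ρ)
      (hS.continuousOn x) (hS.norm_apply_le x)).2
    rw [← hμ] at h1
    set W := ∫ u in Ioi (0 : ℝ), ‖wright ρ (μ : ℂ) (-(u : ℂ))‖ * u ^ beta
    have h2 : ‖G t x‖ ≤ M * W * ‖x‖ := by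
      rw [hG, norm_smul, Real.norm_of_nonneg (by positivity)]
      calc _ ≤ t ^ (ρ * (1 + beta)) * (M * ‖x‖ * ((t ^ ρ) ^ (-(1 + beta)) * W)) :=
            mul_le_mul_of_nonneg_left ((norm_integral_le_integral_norm _).trans h1)
              (by positivity)
        _ = M * W * ‖x‖ * (t ^ (ρ * (1 + beta)) * (t ^ ρ) ^ (-(1 + beta))) := by ring
        _ = _ := by rw [rpow_mul_rpow_rpow_neg ht, mul_one]
    refine (norm_sub_le _ _).trans ?_
    linarith
  · have hl0 : l ≠ 0 := by rintro rfl; simp at hl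
    have hw : 0 < (l ^ (-(ρ : ℂ))).re := re_cpow_neg_pos hρ hρ1 hl
    obtain ⟨R, hR, hRx⟩ := hS.laplace_complex hbeta hw
    have hz : l ^ (gamma : ℂ) ≠ 0 := by simp [Complex.cpow_eq_zero_iff, hl0]
    have hzi : (l ^ (-(ρ : ℂ))) ^ (alpha : ℂ) = (l ^ (gamma : ℂ))⁻¹ := by
      rw [cpow_neg_cpow hρ hρ1 hl, ← Complex.cpow_neg, hγ]
      push_cast
      ring_nf
    rw [hzi] at hR
    refine ⟨_, hR.inverse hB hz, fun x => ?_⟩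
    obtain ⟨hGi, hGl⟩ := laplace_wright_transform hρ hρ1 hbeta (hS.continuousOn x)
      (hS.norm_apply_le x) hl
    have hexpint : IntegrableOn (fun t : ℝ => Complex.exp (-l * t) • x) (Ioi 0) :=
      Integrable.smul_const (integrableOn_exp_mul_complex_Ioi (a := -l) (by simpa using hl) 0) x
    simp_rw [smul_sub]
    rw [integral_sub hexpint hGi, hGl, integral_smul_const,
      integral_exp_mul_complex_Ioi (a := -l) (by simpa using hl) 0]
    simp only [sub_apply, smul_apply,
      ContinuousLinearMap.id_apply]
    rw [hRx x, smul_sub, smul_smul, smul_smul, smul_smul, cpow_neg_cpow hρ hρ1 hl]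
    congr 2
    · rw [Complex.cpow_sub _ _ hl0, Complex.cpow_one]
      field_simp
      simp
    · rw [← Complex.cpow_neg, ← Complex.cpow_add _ _ hl0, ← Complex.cpow_add _ _ hl0,
        ← Complex.cpow_add _ _ hl0]
      have hγ' : (gamma : ℂ) = ρ * alpha := by rw [← Complex.ofReal_mul, ← hγ]
      congr 1
      rw [hγ']
      push_cast
      ring
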